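/- Let n ≥ 2 and let Ω ⊆ ℝⁿ be a bounded domain satisfying the separation property with respect to some x₀ ∈ Ω and some C > 1. If Ω supports a (pn/(n−ps), p)_s-Hajłasz–Sobolev–Poincaré imbedding for some s ∈ (0,1] and some p ∈ (n/(n+s), n/s), then Ω is a John domain. -/

import Mathlib

open MeasureTheory Metric Set
open scoped ENNReal

noncomputable section

/-- Euclidean space `ℝⁿ`. -/
abbrev Eu (n : ℕ) : Type := EuclideanSpace ℝ (Fin n)

/-- A domain: a nonempty open connected subset. -/
def IsDomainEu {n : ℕ} (Ω : Set (Eu n)) : Prop := IsOpen Ω ∧ IsConnected Ω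

/-- The Hajłasz gradient class `𝒟^{s,ρ}_ball(u)` on `Ω`: nonnegative measurable `g` such that
`|u x - u y| ≤ |x-y|^s (g x + g y)` for all `x, y ∈ Ω` off a null set with
`|x - y| < ρ · dist(x, ∂Ω)`. -/
def DBall {n : ℕ} (Ω : Set (Eu n)) (s ρ : ℝ) (u : Eu n → ℝ) : Set (Eu n → ℝ) :=
  {g | Measurable g ∧ (∀ x, 0 ≤ g x) ∧
    ∃ N : Set (Eu n), N ⊆ Ω ∧ volume N = 0 ∧
      ∀ x ∈ Ω \ N, ∀ y ∈ Ω \ N,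
        edist x y < ENNReal.ofReal ρ * EMetric.infEdist x Ωᶜ →
        |u x - u y| ≤ dist x y ^ s * (g x + g y)}

/-- The full Hajłasz gradient class `𝒟^s(u)` on `U`. -/
def DFull {n : ℕ} (U : Set (Eu n)) (s : ℝ) (u : Eu n → ℝ) : Set (Eu n → ℝ) :=
  {g | Measurable g ∧ (∀ x, 0 ≤ g x) ∧
    ∃ N : Set (Eu n), N ⊆ U ∧ volume N = 0 ∧
      ∀ x ∈ U \ N, ∀ y ∈ U \ N, |u x - u y| ≤ dist x y ^ s * (g x + g y)}

/-- `inf_{g ∈ 𝒟^{s,ρ}_ball(u)} ‖g‖_{L^p(Ω)}`. -/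
def ballNormRho {n : ℕ} (Ω : Set (Eu n)) (s p ρ : ℝ) (u : Eu n → ℝ) : ℝ≥0∞ :=
  ⨅ g ∈ DBall Ω s ρ u, eLpNorm g (ENNReal.ofReal p) (volume.restrict Ω)

/-- The `Ṁ^{s,p}_ball(Ω)` seminorm (with `ρ = 1/2`). -/
def ballNorm {n : ℕ} (Ω : Set (Eu n)) (s p : ℝ) (u : Eu n → ℝ) : ℝ≥0∞ :=
  ballNormRho Ω s p (1/2) u

/-- The `Ṁ^{s,p}(U)` seminorm. -/
def fullNorm {n : ℕ} (U : Set (Eu n)) (s p : ℝ) (u : Eu n → ℝ) : ℝ≥0∞ :=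
  ⨅ g ∈ DFull U s u, eLpNorm g (ENNReal.ofReal p) (volume.restrict U)

/-- Membership in `Ṁ^{s,p}_ball(Ω)`. -/
def MemMball {n : ℕ} (Ω : Set (Eu n)) (s p : ℝ) (u : Eu n → ℝ) : Prop :=
  Measurable u ∧ ballNorm Ω s p u < ⊤

/-- Membership in `Ṁ^{s,p}(U)`. -/
def MemMfull {n : ℕ} (U : Set (Eu n)) (s p : ℝ) (u : Eu n → ℝ) : Prop :=
  Measurable u ∧ fullNorm U s p u < ⊤

/-- `Ω` supports a `(pn/(n-ps), p)_s`-Hajłasz–Sobolev–Poincaré imbedding. -/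
def SupportsHSP {n : ℕ} (Ω : Set (Eu n)) (s p : ℝ) : Prop :=
  ∃ C : ℝ, 0 < C ∧ ∀ u : Eu n → ℝ, MemMball Ω s p u →
    eLpNorm (fun x => u x - ⨍ y in Ω, u y)
        (ENNReal.ofReal (p * n / (n - p * s))) (volume.restrict Ω)
      ≤ ENNReal.ofReal C * ballNorm Ω s p u

/-- LLC(2) with constant `b`: points of `Ω \ B(z,r)` lie in the same connected component
of `Ω \ B(z, br)`. -/
def LLC2With {n : ℕ} (Ω : Set (Eu n)) (b : ℝ) : Prop :=
  ∀ (z : Eu n) (r : ℝ), 0 < r →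
    ∀ x ∈ Ω \ ball z r, ∀ y ∈ Ω \ ball z r,
      y ∈ connectedComponentIn (Ω \ ball z (b * r)) x

/-- The LLC(2) property. -/
def LLC2 {n : ℕ} (Ω : Set (Eu n)) : Prop :=
  ∃ b : ℝ, b ∈ Set.Ioo (0:ℝ) 1 ∧ LLC2With Ω b

/-- `Ω` is an `Ṁ^{s,p}_ball`-extension domain. -/
def IsMballExtensionDomain {n : ℕ} (Ω : Set (Eu n)) (s p : ℝ) : Prop :=
  ∃ C : ℝ, 0 < C ∧ ∀ u : Eu n → ℝ, MemMball Ω s p u →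
    ∃ v : Eu n → ℝ, MemMball (Set.univ) s p v ∧ (∀ x ∈ Ω, v x = u x) ∧
      ballNorm (Set.univ) s p v ≤ ENNReal.ofReal C * ballNorm Ω s p u

/-- `Ω` is a John domain: there are `x₀ ∈ Ω` and `C > 0` such that every `x ∈ Ω` is joined to
`x₀` by a curve parametrized by arclength (here: `1`-Lipschitz) with
`dist(γ t, Ωᶜ) ≥ C t`. -/
def IsJohnDomain {n : ℕ} (Ω : Set (Eu n)) : Prop :=
  ∃ x₀ ∈ Ω, ∃ C : ℝ, 0 < C ∧ ∀ x ∈ Ω, ∃ ℓ : ℝ, 0 ≤ ℓ ∧ ∃ γ : ℝ → Eu n,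
    LipschitzOnWith 1 γ (Set.Icc 0 ℓ) ∧ γ 0 = x ∧ γ ℓ = x₀ ∧
    ∀ t ∈ Set.Icc (0:ℝ) ℓ, γ t ∈ Ω ∧ C * t ≤ infDist (γ t) Ωᶜ

/-- Quasihyperbolic distance: infimum over arclength-parametrized (`1`-Lipschitz) curves in `Ω`
joining `x` to `y` of `∫ dist(γ t, Ωᶜ)⁻¹ dt`. -/
def qhDist {n : ℕ} (Ω : Set (Eu n)) (x y : Eu n) : ℝ :=
  sInf { k : ℝ | ∃ ℓ : ℝ, 0 ≤ ℓ ∧ ∃ γ : ℝ → Eu n,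
    LipschitzOnWith 1 γ (Set.Icc 0 ℓ) ∧ γ 0 = x ∧ γ ℓ = y ∧
    (∀ t ∈ Set.Icc (0:ℝ) ℓ, γ t ∈ Ω) ∧
    k = ∫ t in (0:ℝ)..ℓ, (infDist (γ t) Ωᶜ)⁻¹ }

/-- Weak carrot domain (quasihyperbolic boundary condition). -/
def IsWeakCarrot {n : ℕ} (Ω : Set (Eu n)) : Prop :=
  ∃ x₀ ∈ Ω, ∃ C : ℝ, 1 ≤ C ∧ ∀ x ∈ Ω,
    qhDist Ω x x₀ ≤ C * Real.log (C / infDist x Ωᶜ)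

/-- The Luxemburg norm `‖u‖_{φ_s(L)(Ω)}` with `φ_s(t) = exp(t^{n/(n-s)}) - 1`
(value `⊤` when no admissible `t` exists). -/
def phiLux {n : ℕ} (Ω : Set (Eu n)) (s : ℝ) (u : Eu n → ℝ) : ℝ≥0∞ :=
  sInf (ENNReal.ofReal '' { t : ℝ | 0 < t ∧
    (∫⁻ x in Ω, ENNReal.ofReal
        (Real.exp ((|u x| / t) ^ ((n : ℝ) / ((n : ℝ) - s))) - 1)) ≤ 1 })

/-- `Ω` supports an `s`-Hajłasz–Trudinger imbedding. -/
def SupportsHT {n : ℕ} (Ω : Set (Eu n)) (s : ℝ) : Prop :=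
  ∃ C : ℝ, 0 < C ∧ ∀ u : Eu n → ℝ, MemMball Ω s ((n : ℝ) / s) u →
    phiLux Ω s (fun x => u x - ⨍ y in Ω, u y)
      ≤ ENNReal.ofReal C * ballNorm Ω s ((n : ℝ) / s) u

/-- The separation property with respect to `x₀` and `C`. -/
def SeparationProperty {n : ℕ} (Ω : Set (Eu n)) (x₀ : Eu n) (C : ℝ) : Prop :=
  ∀ x ∈ Ω, ∃ γ : ℝ → Eu n, ContinuousOn γ (Set.Icc 0 1) ∧
    (∀ t ∈ Set.Icc (0:ℝ) 1, γ t ∈ Ω) ∧ γ 0 = x ∧ γ 1 = x₀ ∧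
    ∀ t ∈ Set.Ioc (0:ℝ) 1,
      γ '' Set.Icc 0 t ⊆ ball (γ t) (C * infDist (γ t) Ωᶜ) ∨
      ∀ y ∈ γ '' Set.Icc 0 t \ ball (γ t) (C * infDist (γ t) Ωᶜ),
        connectedComponentIn (Ω \ sphere (γ t) (C * infDist (γ t) Ωᶜ)) y ≠
          connectedComponentIn (Ω \ sphere (γ t) (C * infDist (γ t) Ωᶜ)) x₀

/-- The slice property with constant `C`. Lengths of curve portions are measured via the
Lebesgue measure of parameter preimages of arclength (`1`-Lipschitz) parametrizations. -/
def SliceProperty {n : ℕ} (Ω : Set (Eu n)) (C : ℝ) : Prop :=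
  ∀ x ∈ Ω, ∀ y ∈ Ω, ∃ (j : ℕ) (S : ℕ → Set (Eu n)) (L : ℝ) (γ : ℝ → Eu n),
    0 ≤ L ∧ LipschitzOnWith 1 γ (Set.Icc 0 L) ∧ γ 0 = x ∧ γ L = y ∧
    (∀ t ∈ Set.Icc (0:ℝ) L, γ t ∈ Ω) ∧
    (∀ i ≤ j, IsOpen (S i) ∧ S i ⊆ Ω) ∧
    (∀ i ≤ j, ∀ k ≤ j, i ≠ k → Disjoint (S i) (S k)) ∧
    x ∈ S 0 ∧ y ∈ S j ∧
    (∀ i, 0 < i → i < j →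
      connectedComponentIn (Ω \ closure (S i)) x ≠
        connectedComponentIn (Ω \ closure (S i)) y) ∧
    (∀ (LF : ℝ) (F : ℝ → Eu n), 0 ≤ LF → LipschitzOnWith 1 F (Set.Icc 0 LF) →
      F '' Set.Icc 0 LF ⊆ Ω → (∃ t ∈ Set.Icc (0:ℝ) LF, F t = x) →
      (∃ t ∈ Set.Icc (0:ℝ) LF, F t = y) →
      ∀ i, 0 < i → i < j →
        Metric.diam (S i) ≤ C * (volume {t : ℝ | t ∈ Set.Icc (0:ℝ) LF ∧ F t ∈ S i}).toReal) ∧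
    (∀ t ∈ Set.Icc (0:ℝ) L,
      ball (γ t) (C⁻¹ * infDist (γ t) Ωᶜ) ⊆ ⋃ i ∈ Finset.range (j + 1), S i) ∧
    (∀ i ≤ j, ∀ z ∈ γ '' Set.Icc (0:ℝ) L ∩ S i, Metric.diam (S i) ≤ C * infDist z Ωᶜ) ∧
    (∃ xi : ℕ → Eu n, xi 0 = x ∧ xi j = y ∧
      ∀ i ≤ j, xi i ∈ S i ∧ ball (xi i) (C⁻¹ * infDist (xi i) Ωᶜ) ⊆ S i)

/-- `v : Ω → ℝⁿ` is a distributional gradient of `u` on `U`. -/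
def HasDistribGradOn {n : ℕ} (U : Set (Eu n)) (u : Eu n → ℝ) (v : Eu n → Eu n) : Prop :=
  ∀ φ : Eu n → ℝ, ContDiff ℝ (⊤ : ℕ∞) φ → HasCompactSupport φ → tsupport φ ⊆ U →
    ∀ i : Fin n,
      ∫ x in U, u x * fderiv ℝ φ x (EuclideanSpace.single i 1) = - ∫ x in U, v x i * φ x

/-- `u ∈ Ẇ^{1,p}(U)` with distributional gradient `v ∈ L^p(U;ℝⁿ)`. -/
def MemW1p {n : ℕ} (U : Set (Eu n)) (p : ℝ) (u : Eu n → ℝ) (v : Eu n → Eu n) : Prop :=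
  LocallyIntegrableOn u U volume ∧ AEMeasurable v (volume.restrict U) ∧
    eLpNorm v (ENNReal.ofReal p) (volume.restrict U) < ⊤ ∧ HasDistribGradOn U u v

/-- `Ω` is a `Ẇ^{1,p}`-extension domain. -/
def IsW1pExtensionDomain {n : ℕ} (Ω : Set (Eu n)) (p : ℝ) : Prop :=
  ∃ C : ℝ, 0 < C ∧ ∀ u v, MemW1p Ω p u v →
    ∃ u' v', MemW1p (Set.univ) p u' v' ∧ (∀ᵐ x ∂(volume.restrict Ω), u' x = u x) ∧
      eLpNorm v' (ENNReal.ofReal p) volume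
        ≤ ENNReal.ofReal C * eLpNorm v (ENNReal.ofReal p) (volume.restrict Ω)

/-- The (uncentered over radii, centered) Hardy–Littlewood maximal function, `ℝ≥0∞`-valued. -/
def HLMax {n : ℕ} (g : Eu n → ℝ) (y : Eu n) : ℝ≥0∞ :=
  ⨆ (t : ℝ) (_ : 0 < t), (volume (ball y t))⁻¹ * ∫⁻ z in ball y t, ENNReal.ofReal |g z|


lemma geom_sum_aux {n : ℕ} (hn : n ≠ 0) {M : ℝ} (hM : 1 < M) :
    ∃ M' : ℝ, 0 < M' ∧ ∀ (N : ℕ) (a : ℕ → ℝ), (∀ k, 0 < a k) →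
      (∀ i < N, ∑ k ∈ Finset.range (i+1), a k ^ n ≤ M * a i ^ n) →
      ∀ i < N, ∑ k ∈ Finset.range (i+1), a k ≤ M' * a i := by
  have hn0 : (0:ℝ) < n := by positivity
  set th : ℝ := 1 - 1 / M with hth
  have hM0 : 0 < M := by linarith
  have hth0 : 0 ≤ th := by
    have : 1 / M ≤ 1 := by rw [div_le_one hM0]; exact hM.le
    linarith
  have hth1 : th < 1 := by
    have : 0 < 1 / M := by positivity
    linarith
  set ta : ℝ := th ^ (1 / (n:ℝ)) with hta
  have hta0 : 0 ≤ ta := Real.rpow_nonneg hth0 _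
  have hta1 : ta < 1 := Real.rpow_lt_one hth0 hth1 (by positivity)
  refine ⟨M ^ (1/(n:ℝ)) / (1 - ta), div_pos (Real.rpow_pos_of_pos hM0 _) (by linarith), ?_⟩
  intro N a ha hS
  set S : ℕ → ℝ := fun i => ∑ k ∈ Finset.range (i+1), a k ^ n with hSdef
  have hSpos : ∀ i, 0 < S i := fun i =>
    Finset.sum_pos (fun k _ => pow_pos (ha k) n) ⟨0, by simp⟩
  have hsucc : ∀ i, S (i+1) = S i + a (i+1) ^ n := fun i => Finset.sum_range_succ _ _
  have hroot : ∀ k, (a k ^ n) ^ (1/(n:ℝ)) = a k := fun k => by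
    rw [one_div]; exact Real.pow_rpow_inv_natCast (ha k).le hn
  have hak : ∀ k, a k ≤ S k ^ (1/(n:ℝ)) := fun k => by
    rw [← hroot k]
    refine Real.rpow_le_rpow (by have := ha k; positivity) ?_ (by positivity)
    exact Finset.single_le_sum (f := fun k => a k ^ n) (fun j _ => (pow_pos (ha j) n).le)
      (by simp)
  have key : ∀ i < N, ∑ k ∈ Finset.range (i+1), a k ≤ S i ^ (1/(n:ℝ)) / (1 - ta) := by
    intro i
    induction i with
    | zero =>
      intro _
      have h1 := hak 0
      have h2 : 0 ≤ S 0 ^ (1/(n:ℝ)) := Real.rpow_nonneg (hSpos 0).le _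
      rw [le_div_iff₀ (by linarith)]
      simp only [zero_add, Finset.range_one, Finset.sum_singleton]
      nlinarith [ha 0]
    | succ i ih =>
      intro hi
      have h1 := ih (by omega)
      rw [Finset.sum_range_succ]
      have h2 := hak (i+1)
      have h3 : S i ≤ th * S (i+1) := by
        have h4 := hS (i+1) hi
        change S (i+1) ≤ _ at h4
        have h5 := hsucc i
        have h6 : S (i+1) / M ≤ a (i+1) ^ n := by
          rw [div_le_iff₀ hM0]; linarith
        have : th * S (i+1) = S (i+1) - S (i+1) / M := by rw [hth]; ring
        linarith
      have h4 : S i ^ (1/(n:ℝ)) ≤ ta * S (i+1) ^ (1/(n:ℝ)) := by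
        rw [hta, ← Real.mul_rpow hth0 (hSpos _).le]
        exact Real.rpow_le_rpow (hSpos _).le h3 (by positivity)
      have h7 : (0:ℝ) < 1 - ta := by linarith
      rw [le_div_iff₀ h7] at h1 ⊢
      nlinarith
  intro i hi
  refine (key i hi).trans ?_
  have h7 : (0:ℝ) < 1 - ta := by linarith
  rw [div_mul_eq_mul_div]
  refine div_le_div_of_nonneg_right ?_ h7.le
  calc S i ^ (1/(n:ℝ)) ≤ (M * a i ^ n) ^ (1/(n:ℝ)) :=
        Real.rpow_le_rpow (hSpos _).le (hS i hi) (by positivity)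
    _ = _ := by
        rw [Real.mul_rpow hM0.le (by have := ha i; positivity), hroot]

lemma ball_sum_aux {n : ℕ} (hn : 2 ≤ n) {K : ℝ} (hK : 1 ≤ K) (N : ℕ) (p : ℕ → Eu n) (a : ℕ → ℝ)
    (ha : ∀ k, 0 < a k) (hlip : ∀ j k, a j ≤ a k + dist (p k) (p j))
    (hsep : ∀ k j, k < j → j < N → a k / 2 ≤ dist (p k) (p j))
    (hcar : ∀ k j, k ≤ j → j < N → dist (p k) (p j) ≤ K * a j) (i : ℕ) (hi : i < N) :
    ∑ k ∈ Finset.range (i+1), a k ^ n ≤ (12 * (K+1)) ^ n * a i ^ n := by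
  haveI : Nonempty (Fin n) := ⟨⟨0, by omega⟩⟩
  have hdisj : ∀ k j, k < j → j < N → Disjoint (ball (p k) (a k / 6)) (ball (p j) (a j / 6)) := by
    intro k j hkj hj
    apply ball_disjoint_ball
    have h1 := hsep k j hkj hj
    have h2 := hlip j k
    linarith [ha k]
  have hpd : (↑(Finset.range (i+1)) : Set ℕ).PairwiseDisjoint (fun k => ball (p k) (a k / 6)) := by
    intro k hk j hj hkj
    simp only [Finset.coe_range, Set.mem_Iio] at hk hj
    rcases lt_or_gt_of_ne hkj with h | h
    · exact hdisj k j h (by omega)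
    · exact (hdisj j k h (by omega)).symm
  have hsub : (⋃ k ∈ Finset.range (i+1), ball (p k) (a k / 6)) ⊆ ball (p i) (2 * (K+1) * a i) := by
    intro w hw
    simp only [Set.mem_iUnion, Finset.mem_range, mem_ball, exists_prop] at hw ⊢
    obtain ⟨k, hk, hw⟩ := hw
    have h1 := hcar k i (by omega) hi
    have h2 := hlip k i
    rw [dist_comm] at h2
    have h3 := dist_triangle w (p k) (p i)
    nlinarith [ha i]
  have hm : volume (⋃ k ∈ Finset.range (i+1), ball (p k) (a k / 6))
      = ∑ k ∈ Finset.range (i+1), volume (ball (p k) (a k / 6)) :=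
    measure_biUnion_finset hpd (fun k _ => measurableSet_ball)
  have hle := measure_mono (μ := volume) hsub
  rw [hm] at hle
  have hb : ∀ (c : Eu n) (r : ℝ), 0 ≤ r →
      volume (ball c r) = ENNReal.ofReal (r ^ n) * volume (ball (0 : Eu n) 1) := by
    intro c r hr
    have := Measure.addHaar_ball (volume : Measure (Eu n)) c hr
    simpa using this
  rw [hb _ _ (by have := ha i; positivity)] at hle
  rw [Finset.sum_congr rfl (fun k _ => hb (p k) (a k / 6) (by have := ha k; positivity))] at hle
  rw [← Finset.sum_mul, ENNReal.mul_le_mul_iff_left (measure_ball_pos _ _ one_pos).ne'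
    measure_ball_lt_top.ne, ← ENNReal.ofReal_sum_of_nonneg
      (fun k _ => by have := ha k; positivity)] at hle
  rw [ENNReal.ofReal_le_ofReal_iff (by have := ha i; positivity)] at hle
  simp_rw [div_pow] at hle
  rw [← Finset.sum_div, div_le_iff₀ (by positivity)] at hle
  refine hle.trans (le_of_eq ?_)
  rw [← mul_pow, ← mul_pow]
  congr 1; ring

lemma chain_aux {n : ℕ} (Ω : Set (Eu n)) (hΩ : IsOpen Ω) (hne : Ωᶜ.Nonempty) {K : ℝ}
    (γ : ℝ → Eu n) (hγ : ContinuousOn γ (Icc 0 1)) (hin : ∀ t ∈ Icc (0:ℝ) 1, γ t ∈ Ω)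
    (hK : ∀ t ∈ Icc (0:ℝ) 1, ∀ τ ∈ Icc 0 t, dist (γ τ) (γ t) ≤ K * infDist (γ t) Ωᶜ) :
    ∃ (N : ℕ) (p : ℕ → Eu n), p 0 = γ 0 ∧ p N = γ 1 ∧ (∀ k, p k ∈ Ω) ∧
      (∀ k, dist (p k) (p (k+1)) ≤ infDist (p k) Ωᶜ / 2) ∧
      (∀ k j, k < j → j < N → infDist (p k) Ωᶜ / 2 ≤ dist (p k) (p j)) ∧
      (∀ k j, k ≤ j → j < N → dist (p k) (p j) ≤ K * infDist (p j) Ωᶜ) := by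
  have hpos : ∀ y ∈ Ω, 0 < infDist y Ωᶜ := fun y hy =>
    (hΩ.isClosed_compl.notMem_iff_infDist_pos hne).1 (by simpa using hy)
  have hstep : ∀ t : Icc (0:ℝ) 1, ∃ t' : Icc (0:ℝ) 1, t ≤ t' ∧
      dist (γ t) (γ t') ≤ infDist (γ t) Ωᶜ / 2 ∧
      (∀ τ ∈ Icc (0:ℝ) 1, t' ≤ τ → (t':ℝ) < 1 → infDist (γ t) Ωᶜ / 2 ≤ dist (γ t) (γ τ)) := by
    intro t
    have hd := hpos _ (hin t t.2)
    set F : Set ℝ := {τ ∈ Icc (0:ℝ) 1 | dist (γ t) (γ τ) ≤ infDist (γ t) Ωᶜ / 2} with hF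
    have hcont : ContinuousOn (fun τ => dist (γ t) (γ τ)) (Icc 0 1) :=
      (continuous_const.dist continuous_id).comp_continuousOn hγ
    have hFc : IsCompact F := by
      have : IsClosed F := hcont.preimage_isClosed_of_isClosed isClosed_Icc (isClosed_Iic (a := infDist (γ t) Ωᶜ / 2))
      exact isCompact_Icc.of_isClosed_subset this (fun τ h => h.1)
    have htF : (t:ℝ) ∈ F := ⟨t.2, by simp; linarith⟩
    obtain ⟨t', ht'F, ht'⟩ := hFc.exists_isGreatest ⟨_, htF⟩
    refine ⟨⟨t', ht'F.1⟩, ht' htF, ht'F.2, ?_⟩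
    have hgt : ∀ τ ∈ Icc (0:ℝ) 1, t' < τ → infDist (γ t) Ωᶜ / 2 < dist (γ t) (γ τ) := by
      intro τ hτ hlt
      by_contra hcon
      exact absurd (ht' ⟨hτ, not_lt.1 hcon⟩) (not_le.2 hlt)
    intro τ hτ hle h1
    rcases eq_or_lt_of_le hle with h | h
    · simp only at h h1
      subst h
      have hc : ContinuousWithinAt (fun τ => dist (γ t) (γ τ)) (Ioc t' 1) t' :=
        (hcont t' ht'F.1).mono (fun x hx => ⟨ht'F.1.1.trans hx.1.le, hx.2⟩)
      haveI : (nhdsWithin t' (Ioc t' 1)).NeBot := by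
        rw [← mem_closure_iff_nhdsWithin_neBot, closure_Ioc h1.ne]
        exact ⟨le_rfl, h1.le⟩
      refine ge_of_tendsto hc ?_
      filter_upwards [self_mem_nhdsWithin] with x hx
      exact (hgt x ⟨ht'F.1.1.trans hx.1.le, hx.2⟩ hx.1).le
    · exact (hgt τ hτ h).le
  choose f hf1 hf2 hf3 using hstep
  set T : ℕ → Icc (0:ℝ) 1 := fun k => f^[k] ⟨0, by simp⟩ with hT
  have hTs : ∀ k, T (k+1) = f (T k) := fun k => Function.iterate_succ_apply' f k _
  have hmono : Monotone T := monotone_nat_of_le_succ (fun k => by rw [hTs]; exact hf1 _)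
  have hex : ∃ N, (T N : ℝ) = 1 := by
    by_contra hcon
    push Not at hcon
    have hlt : ∀ k, (T k : ℝ) < 1 := fun k => lt_of_le_of_ne (T k).2.2 (hcon k)
    have hmono' : Monotone (fun k => (T k : ℝ)) := fun a b h => hmono h
    have hbdd : BddAbove (Set.range (fun k => (T k : ℝ))) := ⟨1, by
      rintro _ ⟨k, rfl⟩; exact (T k).2.2⟩
    have hlim := tendsto_atTop_ciSup hmono' hbdd
    set L := ⨆ k, (T k : ℝ)
    have hL : L ∈ Icc (0:ℝ) 1 := isClosed_Icc.mem_of_tendsto hlim (Filter.Eventually.of_forall fun k => (T k).2)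
    have hlim2 : Filter.Tendsto (fun k => (T k : ℝ)) Filter.atTop (nhdsWithin L (Icc 0 1)) :=
      tendsto_nhdsWithin_iff.2 ⟨hlim, Filter.Eventually.of_forall fun k => (T k).2⟩
    have hg : Filter.Tendsto (fun k => γ (T k)) Filter.atTop (nhds (γ L)) :=
      (hγ L hL).tendsto.comp hlim2
    have hg' := hg.comp (Filter.tendsto_add_atTop_nat 1)
    have hdist : Filter.Tendsto (fun k => dist (γ (T k)) (γ (T (k+1)))) Filter.atTop (nhds 0) := by
      have := hg.dist hg'
      simpa using this
    have hd2 : Filter.Tendsto (fun k => infDist (γ (T k)) Ωᶜ / 2) Filter.atTop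
        (nhds (infDist (γ L) Ωᶜ / 2)) :=
      (((continuous_infDist_pt Ωᶜ).tendsto _).comp hg).div_const 2
    have := le_of_tendsto_of_tendsto' hd2 hdist (fun k => by
      rw [hTs]
      exact hf3 (T k) _ (f (T k)).2 le_rfl (by rw [← hTs]; exact hlt _))
    linarith [hpos _ (hin L hL)]
  classical
  refine ⟨Nat.find hex, fun k => γ (T k), rfl, ?_, fun k => hin _ (T k).2, ?_, ?_, ?_⟩
  · simp only [Nat.find_spec hex]
  · intro k
    simp only [hTs]; exact hf2 _
  · intro k j hkj hj
    refine hf3 (T k) _ (T j).2 ?_ ?_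
    · rw [← hTs]; exact hmono hkj
    · rw [← hTs]
      exact lt_of_le_of_ne (T (k+1)).2.2 (Nat.find_min hex (by omega))
  · intro k j hkj hj
    exact hK _ (T j).2 _ ⟨(T k).2.1, hmono hkj⟩

lemma extend_aux {n : ℕ} {γ : ℝ → Eu n} {ℓ L : ℝ} (hℓ : 0 ≤ ℓ) (hL : 0 ≤ L) {q : Eu n}
    (h1 : LipschitzOnWith 1 γ (Icc 0 ℓ)) (hd : dist (γ ℓ) q = L) :
    ∃ γ' : ℝ → Eu n, LipschitzOnWith 1 γ' (Icc 0 (ℓ+L)) ∧ (∀ t ≤ ℓ, γ' t = γ t) ∧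
      γ' (ℓ+L) = q ∧ ∀ t ∈ Icc ℓ (ℓ+L), dist (γ' t) (γ ℓ) ≤ L := by
  rcases eq_or_lt_of_le hL with h | h
  · subst h
    refine ⟨γ, by simpa using h1, fun _ _ => rfl, by simpa using dist_eq_zero.1 hd, ?_⟩
    intro t ht
    have : t = ℓ := le_antisymm (by simpa using ht.2) ht.1
    simp [this]
  · set v : Eu n := L⁻¹ • (q - γ ℓ) with hv
    have hvn : ‖v‖ = 1 := by
      rw [hv, norm_smul, ← dist_eq_norm, dist_comm, hd, Real.norm_of_nonneg (by positivity)]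
      field_simp
    set γ' : ℝ → Eu n := fun t => if t ≤ ℓ then γ t else γ ℓ + (t - ℓ) • v with hγ'
    have e1 : ∀ t ≤ ℓ, γ' t = γ t := fun t ht => by simp [hγ', ht]
    have e2 : ∀ t, ℓ ≤ t → γ' t = γ ℓ + (t - ℓ) • v := fun t ht => by
      rcases eq_or_lt_of_le ht with h | h
      · subst h; simp [hγ']
      · simp [hγ', not_le.2 h]
    have d2 : ∀ t t', ℓ ≤ t → ℓ ≤ t' → dist (γ' t) (γ' t') = |t - t'| := by
      intro t t' ht ht'
      rw [e2 t ht, e2 t' ht', dist_add_left, dist_eq_norm, ← sub_smul, norm_smul, hvn]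
      simp
    have key : ∀ t ∈ Icc 0 (ℓ+L), ∀ t' ∈ Icc 0 (ℓ+L), t ≤ t' → dist (γ' t) (γ' t') ≤ t' - t := by
      intro t ht t' ht' htt
      have habs : ∀ a b : ℝ, a ≤ b → |a - b| = b - a := fun a b hab => by
        rw [abs_sub_comm, abs_of_nonneg (by linarith)]
      have d1 : ∀ t t', 0 ≤ t → t ≤ t' → t' ≤ ℓ → dist (γ' t) (γ' t') ≤ t' - t := by
        intro t t' h0 h1' h2
        rw [e1 t (by linarith), e1 t' h2]
        have := h1.dist_le_mul t ⟨h0, by linarith⟩ t' ⟨by linarith, h2⟩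
        rw [Real.dist_eq, habs _ _ h1'] at this
        simpa using this
      rcases le_total t' ℓ with h2 | h2
      · exact d1 t t' ht.1 htt h2
      · rcases le_total t ℓ with h3 | h3
        · have a1 := d1 t ℓ ht.1 h3 le_rfl
          have a2 := d2 ℓ t' le_rfl h2
          rw [habs _ _ h2] at a2
          have := dist_triangle (γ' t) (γ' ℓ) (γ' t')
          linarith
        · rw [d2 t t' h3 h2, habs _ _ htt]
    refine ⟨γ', LipschitzOnWith.of_dist_le_mul ?_, e1, ?_, ?_⟩
    · intro t ht t' ht'
      rw [Real.dist_eq, NNReal.coe_one, one_mul]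
      rcases le_total t t' with h | h
      · rw [abs_sub_comm, abs_of_nonneg (by linarith)]; exact key t ht t' ht' h
      · rw [abs_of_nonneg (by linarith), dist_comm]; exact key t' ht' t ht h
    · rw [e2 _ (by linarith), hv, add_sub_cancel_left, smul_smul, mul_inv_cancel₀ h.ne']
      simp
    · intro t ht
      rw [← e1 ℓ le_rfl, d2 t ℓ ht.1 le_rfl, abs_of_nonneg (by linarith [ht.1])]
      linarith [ht.2]

lemma john_of_carrot {n : ℕ} (hn : 2 ≤ n) (Ω : Set (Eu n)) (hΩ : IsOpen Ω) (hne : Ωᶜ.Nonempty)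
    (x₀ : Eu n) (hx₀ : x₀ ∈ Ω) {K : ℝ} (hK1 : 1 ≤ K)
    (h : ∀ x ∈ Ω, ∃ γ : ℝ → Eu n, ContinuousOn γ (Icc 0 1) ∧ (∀ t ∈ Icc (0:ℝ) 1, γ t ∈ Ω) ∧
      γ 0 = x ∧ γ 1 = x₀ ∧
      ∀ t ∈ Icc (0:ℝ) 1, ∀ τ ∈ Icc 0 t, dist (γ τ) (γ t) ≤ K * infDist (γ t) Ωᶜ) :
    IsJohnDomain Ω := by
  have hpos : ∀ y ∈ Ω, 0 < infDist y Ωᶜ := fun y hy =>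
    (hΩ.isClosed_compl.notMem_iff_infDist_pos hne).1 (by simpa using hy)
  have hmem : ∀ y, 0 < infDist y Ωᶜ → y ∈ Ω := fun y hy => by
    have := (hΩ.isClosed_compl.notMem_iff_infDist_pos hne).2 hy
    simpa using this
  obtain ⟨M', hM', hgeo⟩ := geom_sum_aux (n := n) (by omega) (M := (12 * (K+1)) ^ n)
    (one_lt_pow₀ (by linarith) (by omega))
  refine ⟨x₀, hx₀, (2 * M')⁻¹, by positivity, ?_⟩
  intro x hx
  obtain ⟨γ, hγ, hin, h0, h1, hcar⟩ := h x hx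
  obtain ⟨N, p, hp0, hpN, hpΩ, hstep, hsep, hcar'⟩ := chain_aux Ω hΩ hne γ hγ hin hcar
  have hsum := hgeo N (fun k => infDist (p k) Ωᶜ) (fun k => hpos _ (hpΩ k))
    (fun i hi => ball_sum_aux hn hK1 N p (fun k => infDist (p k) Ωᶜ) (fun k => hpos _ (hpΩ k))
      (fun j k => by
        rw [dist_comm]
        exact infDist_le_infDist_add_dist) hsep hcar' i hi)
  have main : ∀ i ≤ N, ∃ ℓ : ℝ, 0 ≤ ℓ ∧ ℓ ≤ ∑ k ∈ Finset.range i, infDist (p k) Ωᶜ / 2 ∧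
      ∃ σ : ℝ → Eu n, LipschitzOnWith 1 σ (Icc 0 ℓ) ∧ σ 0 = x ∧ σ ℓ = p i ∧
      ∀ t ∈ Icc (0:ℝ) ℓ, σ t ∈ Ω ∧ (2 * M')⁻¹ * t ≤ infDist (σ t) Ωᶜ := by
    intro i
    induction i with
    | zero =>
      intro _
      refine ⟨0, le_rfl, by simp, fun _ => x, ?_, rfl, by rw [hp0, h0], ?_⟩
      · exact LipschitzOnWith.of_dist_le_mul (fun a _ b _ => by simp)
      · intro t ht
        have : t = 0 := le_antisymm ht.2 ht.1
        subst this
        exact ⟨hx, by simpa using infDist_nonneg⟩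
    | succ i ih =>
      intro hi
      obtain ⟨ℓ, hℓ0, hℓ, σ, hσ, hσ0, hσ1, hσ2⟩ := ih (by omega)
      obtain ⟨σ', g1, g2, g3, g4⟩ := extend_aux hℓ0 dist_nonneg hσ (q := p (i+1)) rfl
      rw [hσ1] at g1 g3 g4
      have hst := hstep i
      refine ⟨ℓ + dist (p i) (p (i+1)), by positivity, ?_, σ', g1, by rw [g2 0 hℓ0, hσ0], g3, ?_⟩
      · rw [Finset.sum_range_succ]; linarith
      · intro t ht
        rcases le_total t ℓ with hc | hc
        · rw [g2 t hc]; exact hσ2 t ⟨ht.1, hc⟩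
        · have hh := g4 t ⟨hc, ht.2⟩
          have h5 : infDist (p i) Ωᶜ ≤ infDist (σ' t) Ωᶜ + dist (p i) (σ' t) :=
            infDist_le_infDist_add_dist
          rw [dist_comm] at h5
          have h6 := hpos _ (hpΩ i)
          have h7 : infDist (p i) Ωᶜ / 2 ≤ infDist (σ' t) Ωᶜ := by linarith
          refine ⟨hmem _ (by linarith), ?_⟩
          have h8 := hsum i (by omega)
          rw [Finset.sum_range_succ] at h8
          rw [← Finset.sum_div] at hℓ
          have h9 : t ≤ M' * infDist (p i) Ωᶜ := by
            have := ht.2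
            have : 0 ≤ ∑ k ∈ Finset.range i, infDist (p k) Ωᶜ :=
              Finset.sum_nonneg (fun _ _ => infDist_nonneg)
            linarith
          rw [inv_mul_le_iff₀ (by positivity)]
          nlinarith
  obtain ⟨ℓ, hℓ0, -, σ, a1, a2, a3, a4⟩ := main N le_rfl
  exact ⟨ℓ, hℓ0, σ, a1, a2, by rw [a3, hpN, h1], a4⟩

lemma hsp_cons {n : ℕ} (hn : 2 ≤ n) (Ω : Set (Eu n)) (hΩ : IsOpen Ω)
    (hbd : Bornology.IsBounded Ω) (hne : Ωᶜ.Nonempty) {s p : ℝ} (hp : 0 < p)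
    (hps : p * s < n) (hsp : SupportsHSP Ω s p) (x₀ : Eu n) {δ : ℝ} (hδ : 0 < δ)
    (hB : ball x₀ δ ⊆ Ω) :
    ∃ A : ℝ, 0 < A ∧ ∀ (u : Eu n → ℝ) (G S : Set (Eu n)) (lam : ℝ), Measurable u →
      MeasurableSet G → G ⊆ Ω → MeasurableSet S → S ⊆ Ω → 0 < lam →
      (∀ x ∈ Ω, ∀ y ∈ Ω, dist x y < infDist x Ωᶜ / 2 → |u x - u y| ≤ dist x y ^ s * lam) →
      (∀ x ∈ Ω, ∀ y ∈ Ω, dist x y < infDist x Ωᶜ / 2 → u x ≠ u y → x ∈ G ∨ y ∈ G) →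
      (∀ x ∈ ball x₀ δ, u x = 0) → (∀ x ∈ S, u x = 1) →
      volume.real S ^ (1 / (p * n / (n - p * s))) ≤ A * lam * volume.real G ^ (1/p) := by
  have hn0 : (0:ℝ) < n := by positivity
  set q : ℝ := p * n / (n - p * s) with hq
  have hq0 : 0 < q := div_pos (by positivity) (by linarith)
  have hΩfin : volume Ω ≠ ⊤ := hbd.measure_lt_top.ne
  obtain ⟨C, hC, hCu⟩ := hsp
  set c0 := volume.real (ball x₀ δ) with hc0
  have hc0pos : 0 < c0 := ENNReal.toReal_pos (measure_ball_pos _ _ hδ).ne' measure_ball_lt_top.ne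
  set D := max 1 ((volume.real Ω / c0) ^ (1/q)) with hD
  refine ⟨D * (2 * C), by positivity, ?_⟩
  intro u G S lam hu hG hGΩ hS hSΩ hlam hlip hsupp hzero hone
  set g : Eu n → ℝ := G.indicator (fun _ => lam) with hg
  have hgD : g ∈ DBall Ω s (1/2) u := by
    refine ⟨measurable_const.indicator hG, fun x => indicator_nonneg (fun _ _ => hlam.le) x, ∅,
      by simp, by simp, ?_⟩
    intro x hx y hy hxy
    have hxy' : dist x y < infDist x Ωᶜ / 2 := by
      have h1 : infEDist x Ωᶜ ≠ ⊤ := infEDist_ne_top hne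
      have h2 : ENNReal.ofReal (1/2) * infEDist x Ωᶜ = ENNReal.ofReal (infDist x Ωᶜ / 2) := by
        have h3 : infDist x Ωᶜ / 2 = 1/2 * (infEDist x Ωᶜ).toReal := by rw [infDist]; ring
        rw [h3, ENNReal.ofReal_mul (by norm_num), ENNReal.ofReal_toReal h1]
      change edist x y < ENNReal.ofReal (1/2) * infEDist x Ωᶜ at hxy
      rw [h2, edist_dist] at hxy
      exact (ENNReal.ofReal_lt_ofReal_iff_of_nonneg dist_nonneg).1 hxy
    by_cases hne' : u x = u y
    · rw [hne', sub_self, abs_zero]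
      exact mul_nonneg (Real.rpow_nonneg dist_nonneg _)
        (add_nonneg (indicator_nonneg (fun _ _ => hlam.le) x)
          (indicator_nonneg (fun _ _ => hlam.le) y))
    · refine (hlip x hx.1 y hy.1 hxy').trans ?_
      refine mul_le_mul_of_nonneg_left ?_ (Real.rpow_nonneg dist_nonneg _)
      have e1 : 0 ≤ g x := indicator_nonneg (fun _ _ => hlam.le) x
      have e2 : 0 ≤ g y := indicator_nonneg (fun _ _ => hlam.le) y
      rcases hsupp x hx.1 y hy.1 hxy' hne' with h | h
      · have : g x = lam := indicator_of_mem h _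
        linarith
      · have : g y = lam := indicator_of_mem h _
        linarith
  have hnormE : ∀ (r a : ℝ) (E : Set (Eu n)), 0 < r → 0 ≤ a → MeasurableSet E → E ⊆ Ω →
      eLpNorm (E.indicator (fun _ => a)) (ENNReal.ofReal r) (volume.restrict Ω)
        = ENNReal.ofReal (a * volume.real E ^ (1/r)) := by
    intro r a E hr ha hE hEΩ
    rw [eLpNorm_indicator_const hE (by simpa using hr) ENNReal.ofReal_ne_top,
      Measure.restrict_apply hE, inter_eq_left.2 hEΩ, ENNReal.toReal_ofReal hr.le,
      ENNReal.ofReal_mul ha, Real.enorm_of_nonneg ha,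
      ← ENNReal.ofReal_rpow_of_nonneg measureReal_nonneg (by positivity), ofReal_measureReal
        (measure_ne_top_of_subset hEΩ hΩfin)]
  have hbn : ballNorm Ω s p u ≤ ENNReal.ofReal (lam * volume.real G ^ (1/p)) := by
    rw [← hnormE p lam G hp hlam.le hG hGΩ]
    exact iInf₂_le g hgD
  have hmem : MemMball Ω s p u := ⟨hu, lt_of_le_of_lt hbn ENNReal.ofReal_lt_top⟩
  have hmain := hCu u hmem
  set a := ⨍ y in Ω, u y with ha
  set X := C * (lam * volume.real G ^ (1/p)) with hX
  have hX0 : 0 ≤ X := by positivity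
  have hmain' : eLpNorm (fun x => u x - a) (ENNReal.ofReal q) (volume.restrict Ω)
      ≤ ENNReal.ofReal X := by
    refine hmain.trans ?_
    rw [hX, ENNReal.ofReal_mul hC.le]
    gcongr
  have hset : ∀ E : Set (Eu n), MeasurableSet E → E ⊆ Ω → (∀ x ∈ E, 1/2 ≤ |u x - a|) →
      volume.real E ^ (1/q) ≤ 2 * X := by
    intro E hE hEΩ hh
    have h1 : eLpNorm (E.indicator (fun _ => (1/2:ℝ))) (ENNReal.ofReal q) (volume.restrict Ω)
        ≤ eLpNorm (fun x => u x - a) (ENNReal.ofReal q) (volume.restrict Ω) := by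
      refine eLpNorm_mono (fun x => ?_)
      by_cases hx : x ∈ E
      · rw [indicator_of_mem hx]
        simpa using hh x hx
      · rw [indicator_of_notMem hx]; simp
    rw [hnormE q (1/2) E hq0 (by norm_num) hE hEΩ] at h1
    have h2 := (ENNReal.ofReal_le_ofReal_iff hX0).1 (h1.trans hmain')
    linarith
  have hD1 : 1 ≤ D := le_max_left _ _
  have hfin : volume.real S ^ (1/q) ≤ D * (2 * X) := by
    rcases le_total (1/2) |a| with h | h
    · have h1 := hset _ measurableSet_ball hB (fun x hx => by rw [hzero x hx]; simpa using h)
      have h2 : volume.real S ^ (1/q) ≤ volume.real Ω ^ (1/q) :=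
        Real.rpow_le_rpow measureReal_nonneg (measureReal_mono hSΩ hΩfin) (by positivity)
      have h3 : volume.real Ω ^ (1/q) = (volume.real Ω / c0) ^ (1/q) * c0 ^ (1/q) := by
        rw [← Real.mul_rpow (by positivity) hc0pos.le, div_mul_cancel₀ _ hc0pos.ne']
      rw [h3] at h2
      refine h2.trans ?_
      refine mul_le_mul (le_max_right _ _) h1 (Real.rpow_nonneg hc0pos.le _) (by positivity)
    · have h1 := hset S hS hSΩ (fun x hx => by
        rw [hone x hx]
        have := abs_sub_abs_le_abs_sub 1 a
        rw [abs_one] at this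
        linarith)
      nlinarith
  refine hfin.trans (le_of_eq ?_)
  rw [hX]; ring

lemma seg_aux {n : ℕ} {Ω : Set (Eu n)} {z y₀ : Eu n} {R : ℝ} {x y : Eu n}
    (hx : x ∈ connectedComponentIn (Ω \ sphere z R) y₀)
    (hy : y ∉ connectedComponentIn (Ω \ sphere z R) y₀) (hseg : segment ℝ x y ⊆ Ω) :
    ∃ w ∈ segment ℝ x y, dist w z = R := by
  by_contra hcon
  push Not at hcon
  apply hy
  rw [connectedComponentIn_eq hx]
  exact (convex_segment x y).isPreconnected.subset_connectedComponentIn (left_mem_segment ℝ x y)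
    (show segment ℝ x y ⊆ Ω \ sphere z R from fun w hw => ⟨hseg hw, fun h => hcon w hw h⟩) (right_mem_segment ℝ x y)

lemma seg_sub {n : ℕ} {Ω : Set (Eu n)} {x y : Eu n}
    (h : dist x y < infDist x Ωᶜ / 2) : segment ℝ x y ⊆ Ω := by
  intro w hw
  by_contra hc
  have h1 : infDist x Ωᶜ ≤ dist x w := infDist_le_dist_of_mem hc
  have h2 : dist x w ≤ dist x y := by
    have := dist_add_dist_of_mem_segment hw
    linarith [dist_nonneg (x := w) (y := y)]
  linarith [dist_nonneg (x := x) (y := y)]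

/-- cut-off -/
def cut (r ρ t : ℝ) : ℝ := max 0 (min 1 ((t - r) / (ρ - r)))

lemma cut_lip {r ρ : ℝ} (h : r < ρ) (t t' : ℝ) : |cut r ρ t - cut r ρ t'| ≤ min 1 (|t - t'| / (ρ - r)) := by
  have h0 : 0 < ρ - r := by linarith
  unfold cut
  have e : |t - t'| / (ρ - r) = |(t - r) / (ρ - r) - (t' - r) / (ρ - r)| := by
    rw [← sub_div, abs_div, abs_of_pos h0]; congr 2; ring
  rw [e]
  generalize (t - r) / (ρ - r) = a
  generalize (t' - r) / (ρ - r) = b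
  refine le_min ?_ ?_
  · have h1 : 0 ≤ max 0 (min 1 a) := le_max_left _ _
    have h2 : 0 ≤ max 0 (min 1 b) := le_max_left _ _
    have h3 : max 0 (min 1 a) ≤ 1 := max_le zero_le_one (min_le_left _ _)
    have h4 : max 0 (min 1 b) ≤ 1 := max_le zero_le_one (min_le_left _ _)
    rw [abs_le]; constructor <;> linarith
  · have h1 := abs_max_sub_max_le_max 0 (min 1 a) 0 (min 1 b)
    have h2 := abs_min_sub_min_le_max 1 a 1 b
    simp only [sub_self, abs_zero] at h1 h2
    rw [max_eq_right (abs_nonneg (min 1 a - min 1 b))] at h1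
    rw [max_eq_right (abs_nonneg (a - b))] at h2
    exact h1.trans h2

lemma cut_zero {r ρ t : ℝ} (h : r < ρ) (ht : t ≤ r) : cut r ρ t = 0 := by
  have h0 : 0 < ρ - r := by linarith
  have : (t - r) / (ρ - r) ≤ 0 := div_nonpos_of_nonpos_of_nonneg (by linarith) h0.le
  unfold cut
  exact max_eq_left ((min_le_right _ _).trans this)

lemma cut_one {r ρ t : ℝ} (h : r < ρ) (ht : ρ ≤ t) : cut r ρ t = 1 := by
  have h0 : 0 < ρ - r := by linarith
  have : 1 ≤ (t - r) / (ρ - r) := by rw [le_div_iff₀ h0]; linarith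
  unfold cut
  rw [min_eq_left this]; simp

lemma min_one_le_rpow {s t : ℝ} (hs0 : 0 < s) (hs : s ≤ 1) (ht : 0 ≤ t) : min 1 t ≤ t ^ s := by
  rcases le_total t 1 with h | h
  · rw [min_eq_right h]
    exact Real.self_le_rpow_of_le_one ht h hs
  · rw [min_eq_left h]
    exact Real.one_le_rpow h hs0.le

lemma cut_grad {n : ℕ} {Ω : Set (Eu n)} {z y₀ : Eu n} {R r ρ s : ℝ} (hs0 : 0 < s) (hs : s ≤ 1)
    (hR : R ≤ r) (hr : r < ρ) {x y : Eu n} (h : dist x y < infDist x Ωᶜ / 2) :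
    |(connectedComponentIn (Ω \ sphere z R) y₀).indicator (fun x => cut r ρ (dist x z)) x -
      (connectedComponentIn (Ω \ sphere z R) y₀).indicator (fun x => cut r ρ (dist x z)) y| ≤
      dist x y ^ s * (ρ - r) ^ (-s) := by
  have h0 : 0 < ρ - r := by linarith
  have key : ∀ a b : Eu n, dist a b ≤ dist x y →
      |cut r ρ (dist a z) - cut r ρ (dist b z)| ≤ dist x y ^ s * (ρ - r) ^ (-s) := by
    intro a b hab
    refine (cut_lip hr _ _).trans ?_
    rw [Real.rpow_neg h0.le, ← div_eq_mul_inv, ← Real.div_rpow dist_nonneg h0.le]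
    refine le_trans ?_ (min_one_le_rpow hs0 hs (by positivity))
    refine min_le_min_left _ (div_le_div_of_nonneg_right ?_ h0.le)
    exact (abs_dist_sub_le _ _ _).trans hab
  have hseg := seg_sub h
  set T := connectedComponentIn (Ω \ sphere z R) y₀ with hT
  by_cases hx : x ∈ T <;> by_cases hy : y ∈ T
  · rw [indicator_of_mem hx, indicator_of_mem hy]; exact key x y le_rfl
  · rw [indicator_of_mem hx, indicator_of_notMem hy]
    obtain ⟨w, hw, hwz⟩ := seg_aux hx hy hseg
    have hk := key x w (by
      have := dist_add_dist_of_mem_segment hw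
      linarith [dist_nonneg (x := w) (y := y)])
    rwa [hwz, cut_zero hr hR] at hk
  · rw [indicator_of_notMem hx, indicator_of_mem hy]
    rw [segment_symm] at hseg
    obtain ⟨w, hw, hwz⟩ := seg_aux hy hx hseg
    have hk := key w y (by
      have := dist_add_dist_of_mem_segment hw
      rw [dist_comm y w, dist_comm y x] at this
      linarith [dist_nonneg (x := w) (y := x)])
    rwa [hwz, cut_zero hr hR] at hk
  · rw [indicator_of_notMem hx, indicator_of_notMem hy]
    simp only [sub_self, abs_zero]
    positivity

lemma stamp_aux {L W0 r0 : ℝ} (hL : 0 ≤ L) (hW0 : 0 < W0) (W : ℝ → ℝ) (hW : Antitone W)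
    (hnn : ∀ r, 0 ≤ W r)
    (h0 : W r0 ≤ W0)
    (hstep : ∀ r w, r0 ≤ r → 0 < w → W r ≤ w → W (r + L * w) ≤ w / 2) :
    W (r0 + 2 * L * W0) = 0 := by
  have key : ∀ j : ℕ, W (r0 + 2 * L * W0 * (1 - (1/2)^j)) ≤ W0 * (1/2)^j := by
    intro j
    induction j with
    | zero => simpa using h0
    | succ j ih =>
      have h1 : (1/2:ℝ)^j ≤ 1 := pow_le_one₀ (by norm_num) (by norm_num)
      have := hstep _ (W0 * (1/2)^j) (by
        have : 0 ≤ 2 * L * W0 * (1 - (1/2)^j) := mul_nonneg (by positivity) (by linarith)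
        linarith) (by positivity) ih
      convert this using 1
      · congr 1; rw [pow_succ]; ring
      · rw [pow_succ]; ring
  refine le_antisymm ?_ (hnn _)
  have hlim : Filter.Tendsto (fun j : ℕ => W0 * (1/2:ℝ)^j) Filter.atTop (nhds 0) := by
    simpa using (tendsto_pow_atTop_nhds_zero_of_lt_one (r := (1/2:ℝ)) (by norm_num) (by norm_num)).const_mul W0
  refine ge_of_tendsto' hlim (fun j => le_trans (hW ?_) (key j))
  have h1 : 0 ≤ (1/2:ℝ)^j := by positivity
  have : 0 ≤ 2 * L * W0 := by positivity
  nlinarith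

lemma conv_aux {n : ℕ} (hn : 2 ≤ n) {s p v w A h : ℝ} (hs0 : 0 < s) (hp : 0 < p)
    (hps : p * s < n) (hv : 0 ≤ v) (hw : 0 ≤ w) (hh : 0 < h)
    (hle : v ^ (1 / (p * n / (n - p * s))) ≤ A * h ^ (-s) * w ^ (1/p)) :
    (v ^ (1/(n:ℝ))) ^ ((n - p * s) / p) ≤
      A * ((w ^ (1/(n:ℝ))) / h) ^ s * (w ^ (1/(n:ℝ))) ^ ((n - p * s) / p) := by
  have hn0 : (0:ℝ) < n := by positivity
  have hps' : 0 < n - p * s := by linarith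
  have e1 : (v ^ (1/(n:ℝ))) ^ ((n - p * s) / p) = v ^ (1 / (p * n / (n - p * s))) := by
    rw [← Real.rpow_mul hv]; congr 1; field_simp
  have e2 : w ^ (1/p) = (w ^ (1/(n:ℝ))) ^ s * (w ^ (1/(n:ℝ))) ^ ((n - p * s) / p) := by
    rw [← Real.rpow_add_of_nonneg (by positivity) hs0.le (by positivity), ← Real.rpow_mul hw]
    congr 1; field_simp; ring
  rw [e1, Real.div_rpow (by positivity) hh.le]
  refine hle.trans (le_of_eq ?_)
  rw [e2, Real.rpow_neg hh.le]; ring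

set_option maxHeartbeats 1600000 in
lemma carrot_aux {n : ℕ} (hn : 2 ≤ n) (Ω : Set (Eu n)) (hΩ : IsOpen Ω)
    (hbd : Bornology.IsBounded Ω) (hne : Ωᶜ.Nonempty) (x₀ : Eu n) (hx₀ : x₀ ∈ Ω)
    {C : ℝ} (hC : 1 < C) {s p : ℝ} (hs0 : 0 < s) (hs : s ≤ 1) (hp : 0 < p)
    (hps : p * s < n) (hsp : SupportsHSP Ω s p) :
    ∃ K : ℝ, 0 < K ∧ ∀ z ∈ Ω, infDist z Ωᶜ ≤ infDist x₀ Ωᶜ / (8 * C) →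
      ∀ y₀ ∈ Ω \ sphere z (C * infDist z Ωᶜ),
        connectedComponentIn (Ω \ sphere z (C * infDist z Ωᶜ)) y₀ ≠
          connectedComponentIn (Ω \ sphere z (C * infDist z Ωᶜ)) x₀ →
        dist y₀ z ≤ K * infDist z Ωᶜ := by
  have hn0 : (0:ℝ) < n := by positivity
  haveI : Nonempty (Fin n) := ⟨⟨0, by omega⟩⟩
  have hpos : ∀ y ∈ Ω, 0 < infDist y Ωᶜ := fun y hy =>
    (hΩ.isClosed_compl.notMem_iff_infDist_pos hne).1 (by simpa using hy)
  have hδ := hpos x₀ hx₀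
  set δ := infDist x₀ Ωᶜ with hδdef
  have hball : ball x₀ (δ/4) ⊆ Ω := by
    intro w hw
    by_contra hc
    have h1 : δ ≤ dist x₀ w := infDist_le_dist_of_mem hc
    rw [mem_ball, dist_comm] at hw
    linarith
  obtain ⟨A, hA, hmain⟩ := hsp_cons hn Ω hΩ hbd hne hp hps hsp x₀ (by positivity : 0 < δ/4) hball
  set e : ℝ := (n - p * s) / p with he
  have he0 : 0 < e := div_pos (by linarith) hp
  set om : ℝ := volume.real (ball (0 : Eu n) 1) ^ (1/(n:ℝ)) with hom
  have hompos : 0 < om := Real.rpow_pos_of_pos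
    (ENNReal.toReal_pos (measure_ball_pos _ _ one_pos).ne' measure_ball_lt_top.ne) _
  set L : ℝ := (A * 2 ^ e) ^ (1/s) with hL
  have hL0 : 0 < L := by positivity
  have hLs : L ^ s = A * 2 ^ e := by
    rw [hL, ← Real.rpow_mul (by positivity), one_div, inv_mul_cancel₀ hs0.ne', Real.rpow_one]
  set A2 : ℝ := (A * (6 * om) ^ s) ^ (1/e) * (6 * C * om) with hA2
  have hA20 : 0 < A2 := by positivity
  refine ⟨2 * C + 2 * L * A2, by positivity, ?_⟩
  intro z hz hzd y₀ hy₀ hcomp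
  have hd := hpos z hz
  set d := infDist z Ωᶜ with hddef
  have hCd : C * d ≤ δ / 8 := by
    rw [le_div_iff₀ (by positivity)] at hzd
    linarith
  have hxz : δ ≤ d + dist x₀ z := infDist_le_infDist_add_dist
  have hdC : d ≤ C * d := by nlinarith
  set T := connectedComponentIn (Ω \ sphere z (C * d)) y₀ with hT
  have hUo : IsOpen (Ω \ sphere z (C * d)) := hΩ.sdiff isClosed_sphere
  have hTo : IsOpen T := hUo.connectedComponentIn
  have hTΩ : T ⊆ Ω := (connectedComponentIn_subset _ _).trans sdiff_subset
  have hy₀T : y₀ ∈ T := mem_connectedComponentIn hy₀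
  have hB0 : ∀ x ∈ ball x₀ (δ/4), x ∉ T := by
    intro x hx hxT
    apply hcomp
    have hsub : ball x₀ (δ/4) ⊆ Ω \ sphere z (C * d) := by
      intro w hw
      refine ⟨hball hw, fun hws => ?_⟩
      rw [mem_sphere] at hws
      rw [mem_ball, dist_comm] at hw
      have := dist_triangle x₀ w z
      linarith
    have h1 : x ∈ connectedComponentIn (Ω \ sphere z (C * d)) x₀ :=
      (convex_ball x₀ (δ/4)).isPreconnected.subset_connectedComponentIn
        (mem_ball_self (by positivity)) hsub hx
    rw [connectedComponentIn_eq h1]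
    exact connectedComponentIn_eq hxT
  have hTm : ∀ r, MeasurableSet {x ∈ T | r < dist x z} := fun r =>
    (hTo.inter (isOpen_lt continuous_const (continuous_id.dist continuous_const))).measurableSet
  have hTfin : ∀ r, volume {x ∈ T | r < dist x z} ≠ ⊤ := fun r =>
    measure_ne_top_of_subset ((sep_subset _ _).trans hTΩ) hbd.measure_lt_top.ne
  have hmeas : ∀ r ρ : ℝ, Measurable (T.indicator (fun x => cut r ρ (dist x z))) := by
    intro r ρ
    refine Measurable.indicator ?_ hTo.measurableSet
    unfold cut
    fun_prop
  -- general estimate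
  have gen : ∀ r ρ, C * d ≤ r → r < ρ → ∀ G : Set (Eu n), MeasurableSet G → G ⊆ Ω →
      (∀ x ∈ Ω, ∀ y ∈ Ω, dist x y < infDist x Ωᶜ / 2 →
        T.indicator (fun x => cut r ρ (dist x z)) x ≠
          T.indicator (fun x => cut r ρ (dist x z)) y → x ∈ G ∨ y ∈ G) →
      (volume.real {x ∈ T | ρ < dist x z} ^ (1/(n:ℝ))) ^ e ≤
        A * ((volume.real G ^ (1/(n:ℝ))) / (ρ - r)) ^ s * (volume.real G ^ (1/(n:ℝ))) ^ e := by
    intro r ρ hr hρ G hG hGΩ hsupp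
    have hρr : 0 < ρ - r := by linarith
    refine conv_aux hn hs0 hp hps measureReal_nonneg measureReal_nonneg hρr ?_
    refine hmain _ G _ _ (hmeas r ρ) hG hGΩ (hTm ρ) ((sep_subset _ _).trans hTΩ)
      (Real.rpow_pos_of_pos hρr _) (fun x _ y _ hxy => cut_grad hs0 hs hr hρ hxy) hsupp
      (fun x hx => indicator_of_notMem (hB0 x hx) _) ?_
    intro x hx
    rw [indicator_of_mem hx.1, cut_one hρ hx.2.le]
  set W : ℝ → ℝ := fun r => volume.real {x ∈ T | r < dist x z} ^ (1/(n:ℝ)) with hW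
  have hWnn : ∀ r, 0 ≤ W r := fun r => Real.rpow_nonneg measureReal_nonneg _
  have hWanti : Antitone W := by
    intro a b hab
    refine Real.rpow_le_rpow measureReal_nonneg ?_ (by positivity)
    exact measureReal_mono (fun x hx => ⟨hx.1, lt_of_le_of_lt hab hx.2⟩) (hTfin a)
  have hstep : ∀ r w, 2 * C * d ≤ r → 0 < w → W r ≤ w → W (r + L * w) ≤ w / 2 := by
    intro r w hr hw hWr
    have hLw : 0 < L * w := by positivity
    have h1 := gen r (r + L * w) (by nlinarith) (by linarith) {x ∈ T | r < dist x z} (hTm r)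
      ((sep_subset _ _).trans hTΩ) (by
        intro x _ y _ _ hne'
        by_contra hcon
        push Not at hcon
        have h0 : ∀ x, x ∉ {x ∈ T | r < dist x z} →
            T.indicator (fun x => cut r (r + L * w) (dist x z)) x = 0 := by
          intro x hx
          by_cases hxT : x ∈ T
          · rw [indicator_of_mem hxT]
            refine cut_zero (by linarith) ?_
            by_contra hh
            exact hx ⟨hxT, not_le.1 hh⟩
          · exact indicator_of_notMem hxT _
        exact hne' (by rw [h0 x hcon.1, h0 y hcon.2]))
    rw [add_sub_cancel_left] at h1
    change W (r + L * w) ^ e ≤ A * (W r / (L * w)) ^ s * W r ^ e at h1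
    have h2 : A * (W r / (L * w)) ^ s * W r ^ e ≤ (w/2) ^ e := by
      have a1 : (W r / (L * w)) ^ s ≤ (w / (L * w)) ^ s :=
        Real.rpow_le_rpow (div_nonneg (hWnn r) hLw.le) (by gcongr) hs0.le
      have a2 : W r ^ e ≤ w ^ e := Real.rpow_le_rpow (hWnn r) hWr he0.le
      have a3 : (w / (L * w)) ^ s = (A * 2 ^ e)⁻¹ := by
        rw [← hLs, ← Real.inv_rpow hL0.le]; congr 1; field_simp
      calc A * (W r / (L * w)) ^ s * W r ^ e ≤ A * (w / (L * w)) ^ s * w ^ e := by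
            gcongr
        _ = (w/2) ^ e := by
            rw [a3, Real.div_rpow hw.le (by norm_num)]
            field_simp
    exact (Real.rpow_le_rpow_iff (hWnn _) (by positivity) he0).1 (h1.trans h2)
  have hbase : W (2 * C * d) ≤ A2 * d := by
    have h1 := gen (C * d) (2 * C * d) le_rfl (by nlinarith) (Ω ∩ ball z (6 * C * d))
      (hΩ.measurableSet.inter measurableSet_ball) inter_subset_left (by
        intro x hx y hy hxy hne'
        by_contra hcon
        push Not at hcon
        have hx6 : 6 * C * d ≤ dist x z := by
          by_contra hh; exact hcon.1 ⟨hx, not_le.1 hh⟩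
        have hy6 : 6 * C * d ≤ dist y z := by
          by_contra hh; exact hcon.2 ⟨hy, not_le.1 hh⟩
        have hdx : infDist x Ωᶜ ≤ d + dist x z := infDist_le_infDist_add_dist
        have hseg := seg_sub hxy
        have hav : ∀ w ∈ segment ℝ x y, dist w z ≠ C * d := by
          intro w hw hwz
          have b1 := dist_add_dist_of_mem_segment hw
          have b2 := dist_triangle x w z
          have b3 := dist_nonneg (x := w) (y := y)
          linarith
        have hiff : x ∈ T ↔ y ∈ T := by
          constructor
          · intro hxT
            by_contra hyT
            obtain ⟨w, hw, hwz⟩ := seg_aux hxT hyT hseg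
            exact hav w hw hwz
          · intro hyT
            by_contra hxT
            obtain ⟨w, hw, hwz⟩ := seg_aux hyT hxT (by rw [segment_symm]; exact hseg)
            rw [segment_symm] at hw
            exact hav w hw hwz
        apply hne'
        by_cases hxT : x ∈ T
        · rw [indicator_of_mem hxT, indicator_of_mem (hiff.1 hxT),
            cut_one (by nlinarith) (by nlinarith), cut_one (by nlinarith) (by nlinarith)]
        · rw [indicator_of_notMem hxT, indicator_of_notMem (fun h => hxT (hiff.2 h))])
    set b := volume.real (Ω ∩ ball z (6 * C * d)) ^ (1/(n:ℝ)) with hb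
    have hb0 : 0 ≤ b := Real.rpow_nonneg measureReal_nonneg _
    have hb1 : b ≤ 6 * C * d * om := by
      have c1 : volume.real (Ω ∩ ball z (6 * C * d)) ≤ volume.real (ball z (6 * C * d)) :=
        measureReal_mono inter_subset_right measure_ball_lt_top.ne
      have c2 : volume.real (ball z (6 * C * d))
          = (6 * C * d) ^ n * volume.real (ball (0 : Eu n) 1) := by
        have := Measure.addHaar_ball (volume : Measure (Eu n)) z (by positivity : 0 ≤ 6 * C * d)
        rw [measureReal_def, this, ENNReal.toReal_mul, ENNReal.toReal_ofReal (by positivity)]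
        simp [measureReal_def]
      rw [c2] at c1
      calc b ≤ ((6 * C * d) ^ n * volume.real (ball (0 : Eu n) 1)) ^ (1/(n:ℝ)) :=
            Real.rpow_le_rpow measureReal_nonneg c1 (by positivity)
        _ = _ := by
            rw [Real.mul_rpow (by positivity) measureReal_nonneg, one_div,
              Real.pow_rpow_inv_natCast (by positivity) (by omega), hom, one_div]
    change W (2 * C * d) ^ e ≤ _ at h1
    have hsub : 2 * C * d - C * d = C * d := by ring
    rw [hsub] at h1
    have hCd0 : 0 < C * d := by positivity
    have h2 : A * (b / (C * d)) ^ s * b ^ e ≤ (A2 * d) ^ e := by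
      have a1 : (b / (C * d)) ^ s ≤ (6 * om) ^ s := by
        refine Real.rpow_le_rpow (by positivity) ?_ hs0.le
        rw [div_le_iff₀ hCd0]; linarith
      have a2 : b ^ e ≤ (6 * C * d * om) ^ e := Real.rpow_le_rpow hb0 hb1 he0.le
      calc A * (b / (C * d)) ^ s * b ^ e ≤ A * (6 * om) ^ s * (6 * C * d * om) ^ e := by gcongr
        _ = (A2 * d) ^ e := by
            have : A2 * d = (A * (6 * om) ^ s) ^ (1/e) * (6 * C * d * om) := by rw [hA2]; ring
            have h3 : ((A * (6 * om) ^ s) ^ (1/e)) ^ e = A * (6 * om) ^ s := by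
              have h4 : 0 ≤ A * (6 * om) ^ s := by positivity
              rw [← Real.rpow_mul h4, one_div, inv_mul_cancel₀ he0.ne', Real.rpow_one]
            have h5 : 0 ≤ (A * (6 * om) ^ s) ^ (1/e) := by positivity
            have h6 : 0 ≤ 6 * C * d * om := by positivity
            rw [this, Real.mul_rpow h5 h6, h3]
    exact (Real.rpow_le_rpow_iff (hWnn _) (by positivity) he0).1 (h1.trans h2)
  have hz0 := stamp_aux hL0.le (by positivity : 0 < A2 * d) W hWanti hWnn hbase hstep
  have hz1 : 2 * C * d + 2 * L * (A2 * d) = (2 * C + 2 * L * A2) * d := by ring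
  rw [hz1] at hz0
  by_contra hcon
  push Not at hcon
  have hvz : volume.real {x ∈ T | (2 * C + 2 * L * A2) * d < dist x z} = 0 := by
    by_contra hh
    exact (Real.rpow_pos_of_pos (lt_of_le_of_ne measureReal_nonneg (Ne.symm hh)) _).ne' hz0
  have hopen : IsOpen {x ∈ T | (2 * C + 2 * L * A2) * d < dist x z} :=
    hTo.inter (isOpen_lt continuous_const (continuous_id.dist continuous_const))
  have hp1 := hopen.measure_pos (volume : Measure (Eu n)) ⟨y₀, hy₀T, hcon⟩
  exact (ENNReal.toReal_pos hp1.ne' (hTfin _)).ne' hvz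

/-- A bounded domain with the separation property supporting a
`(pn/(n-ps), p)_s`-HSP imbedding for some admissible `s, p` is a John domain. -/
theorem stmt4 {n : ℕ} (hn : 2 ≤ n) (Ω : Set (Eu n)) (hΩ : IsDomainEu Ω)
    (hbd : Bornology.IsBounded Ω) (x₀ : Eu n) (hx₀ : x₀ ∈ Ω) (C : ℝ) (hC : 1 < C)
    (hsep : SeparationProperty Ω x₀ C)
    (hsp : ∃ s ∈ Set.Ioc (0:ℝ) 1, ∃ p : ℝ,
      (n : ℝ) / (n + s) < p ∧ p < (n : ℝ) / s ∧ SupportsHSP Ω s p) :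
    IsJohnDomain Ω := by
  obtain ⟨s, ⟨hs0, hs⟩, p, hp1, hp2, hsp⟩ := hsp
  have hn0 : (0:ℝ) < n := by positivity
  haveI : Nonempty (Fin n) := ⟨⟨0, by omega⟩⟩
  have hp : 0 < p := lt_trans (by positivity) hp1
  have hps : p * s < n := (lt_div_iff₀ hs0).1 hp2
  have hne : Ωᶜ.Nonempty := by
    rw [nonempty_compl]
    rintro rfl
    exact NormedSpace.unbounded_univ ℝ (Eu n) hbd
  have hpos : ∀ y ∈ Ω, 0 < infDist y Ωᶜ := fun y hy =>
    (hΩ.1.isClosed_compl.notMem_iff_infDist_pos hne).1 (by simpa using hy)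
  have hδ := hpos x₀ hx₀
  obtain ⟨K, hK, hmain⟩ := carrot_aux hn Ω hΩ.1 hbd hne x₀ hx₀ hC hs0 hs hp hps hsp
  have hdiam : 0 ≤ Metric.diam Ω := Metric.diam_nonneg
  set Q := Metric.diam Ω * (8 * C) / infDist x₀ Ωᶜ with hQ
  have hQ0 : 0 ≤ Q := by positivity
  refine john_of_carrot hn Ω hΩ.1 hne x₀ hx₀ (K := 1 + C + K + Q) (by linarith) ?_
  intro x hx
  obtain ⟨γ, hγ, hin, h0, h1, hS⟩ := hsep x hx
  refine ⟨γ, hγ, hin, h0, h1, ?_⟩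
  intro t ht τ hτ
  have hτ1 : τ ∈ Icc (0:ℝ) 1 := ⟨hτ.1, hτ.2.trans ht.2⟩
  have hd := hpos _ (hin t ht)
  have hmono : ∀ K', K' ≤ 1 + C + K + Q → dist (γ τ) (γ t) ≤ K' * infDist (γ t) Ωᶜ →
      dist (γ τ) (γ t) ≤ (1 + C + K + Q) * infDist (γ t) Ωᶜ := fun K' h1 h2 =>
    h2.trans (mul_le_mul_of_nonneg_right h1 hd.le)
  rcases eq_or_lt_of_le ht.1 with ht0 | ht0
  · have : τ = t := le_antisymm hτ.2 (by rw [← ht0]; exact hτ.1)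
    rw [this, dist_self]; positivity
  rcases le_or_gt (infDist (γ t) Ωᶜ) (infDist x₀ Ωᶜ / (8 * C)) with hc | hc
  · rcases le_or_gt (dist (γ τ) (γ t)) (C * infDist (γ t) Ωᶜ) with hc2 | hc2
    · exact hmono C (by linarith) hc2
    · have hnb : γ τ ∉ ball (γ t) (C * infDist (γ t) Ωᶜ) := by
        rw [mem_ball]; exact not_lt.2 hc2.le
      refine hmono K (by linarith) (hmain (γ t) (hin t ht) hc (γ τ) ⟨hin τ hτ1, ?_⟩ ?_)
      · rw [mem_sphere]; exact hc2.ne'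
      · rcases hS t ⟨ht0, ht.2⟩ with h | h
        · exact absurd (h ⟨τ, hτ, rfl⟩) hnb
        · exact h _ ⟨⟨τ, hτ, rfl⟩, hnb⟩
  · refine hmono Q (by linarith) ?_
    have h2 := dist_le_diam_of_mem hbd (hin τ hτ1) (hin t ht)
    refine h2.trans ?_
    rw [div_lt_iff₀ (by positivity)] at hc
    rw [hQ, div_mul_eq_mul_div, le_div_iff₀ hδ]
    nlinarith
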